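/- Corollary (idealized minimizer). Suppose there exist t* ∈ (0,1) and X* ∈ E with t*·f₊(X*) < 1, let σ ∈ (0,1), t⁰ ∈ [0,t*) with t⁰·f₊(X⁰) < 1, and let (X^k), (t^k) satisfy the QIS update rule t^{k+1} = t^k + σ·(1 − t^k·f₊(X^{k+1}))/f₊(X^{k+1}) together with the exact-minimizer condition W(X^{k+1}, t^k) = inf_{Y∈E} W(Y, t^k) (attained) for every k. Then there exists a finite K such that t^K ≥ t* and every global minimizer Y of W(·, t^K) satisfies f i Y < 1/t* for all i ∈ ι; i.e. the global minimum of W(X, t^K) belongs to the admissible set of bounded-distortion configurations. -/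

import Mathlib

open Finset

/-- The worst-element distortion `f₊(X) = max_i f i X`. -/
noncomputable def fplus {ι E : Type*} [Fintype ι] [Nonempty ι]
    (f : ι → E → ℝ) (X : E) : ℝ :=
  Finset.univ.sup' Finset.univ_nonempty (fun i => f i X)

/-- The stiffened energy `W(X,t)`, with values in `[0,∞]`: it is
`Σᵢ vᵢ · (fᵢ X)/(1 - t·fᵢ X)` when `t·f₊(X) < 1`, and `+∞` when
`t·f₊(X) ≥ 1`. -/
noncomputable def W {ι E : Type*} [Fintype ι] [Nonempty ι]
    (v : ι → ℝ) (f : ι → E → ℝ) (X : E) (t : ℝ) : ENNReal :=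
  if t * fplus f X < 1 then
    ENNReal.ofReal (∑ i, v i * (f i X / (1 - t * f i X)))
  else ⊤

section StiffenedEnergy

variable {ι E : Type*} [Fintype ι] [Nonempty ι] {v : ι → ℝ} {f : ι → E → ℝ}

theorem le_fplus (f : ι → E → ℝ) (X : E) (i : ι) : f i X ≤ fplus f X :=
  Finset.le_sup' (fun i => f i X) (Finset.mem_univ i)

theorem exists_eq_fplus (f : ι → E → ℝ) (X : E) : ∃ i, fplus f X = f i X := by
  obtain ⟨i, -, hi⟩ := Finset.exists_mem_eq_sup' Finset.univ_nonempty (fun i => f i X)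
  exact ⟨i, hi⟩

theorem one_le_fplus (hf : ∀ i X, 1 ≤ f i X) (X : E) : 1 ≤ fplus f X := by
  obtain ⟨i, hi⟩ := exists_eq_fplus f X
  exact hi ▸ hf i X

theorem W_lt_top_iff {X : E} {t : ℝ} : W v f X t < ⊤ ↔ t * fplus f X < 1 := by
  unfold W
  split_ifs with h <;> simp [h]

theorem one_sub_mul_pos {X : E} {t : ℝ} (ht : 0 ≤ t) (h : t * fplus f X < 1) (i : ι) :
    0 < 1 - t * f i X := by
  have := mul_le_mul_of_nonneg_left (le_fplus f X i) ht
  linarith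

theorem W_mono (hv : ∀ i, 0 < v i) (hf : ∀ i X, 1 ≤ f i X) {X : E} {s t : ℝ}
    (hs : 0 ≤ s) (hst : s ≤ t) : W v f X s ≤ W v f X t := by
  by_cases ht : t * fplus f X < 1
  · have hle : s * fplus f X < 1 :=
      (mul_le_mul_of_nonneg_right hst (by linarith [one_le_fplus hf X])).trans_lt ht
    rw [W, W, if_pos hle, if_pos ht]
    refine ENNReal.ofReal_le_ofReal (Finset.sum_le_sum fun i _ => ?_)
    have hfi := hf i X
    refine mul_le_mul_of_nonneg_left ?_ (hv i).le
    refine div_le_div_of_nonneg_left (by linarith) (one_sub_mul_pos (hs.trans hst) ht i) ?_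
    have := mul_le_mul_of_nonneg_right hst (by linarith : 0 ≤ f i X)
    linarith
  · rw [W, W, if_neg ht]
    exact le_top

/-- Sublevel sets of the energy keep the worst element uniformly away from the barrier. -/
theorem exists_pos_le_of_W_le (hv : ∀ i, 0 < v i) (hf : ∀ i X, 1 ≤ f i X)
    {C : ENNReal} (hC : C < ⊤) :
    ∃ δ > 0, ∀ (X : E) (t : ℝ), 0 ≤ t → W v f X t ≤ C →
      δ ≤ (1 - t * fplus f X) / fplus f X := by
  obtain ⟨j, hj⟩ := Finite.exists_min v
  have hB : 0 < C.toReal + 1 := by positivity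
  refine ⟨v j / (C.toReal + 1), div_pos (hv j) hB, fun X t ht hW => ?_⟩
  have hlt : t * fplus f X < 1 := W_lt_top_iff.1 (hW.trans_lt hC)
  rw [W, if_pos hlt, ENNReal.ofReal_le_iff_le_toReal hC.ne] at hW
  obtain ⟨i, hi⟩ := exists_eq_fplus f X
  have hterm : v i * (f i X / (1 - t * f i X)) ≤ C.toReal := by
    refine le_trans ?_ hW
    refine Finset.single_le_sum (f := fun i => v i * (f i X / (1 - t * f i X)))
      (fun k _ => ?_) (Finset.mem_univ i)
    have := hf k X
    exact mul_nonneg (hv k).le (div_nonneg (by linarith) (one_sub_mul_pos ht hlt k).le)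
  have hd := one_sub_mul_pos ht hlt i
  have hfi : 0 < f i X := by linarith [hf i X]
  rw [hi, div_le_div_iff₀ hB hfi]
  rw [← mul_div_assoc, div_le_iff₀ hd] at hterm
  nlinarith [mul_le_mul_of_nonneg_right (hj i) hfi.le]

end StiffenedEnergy

/-- Corollary (idealized minimizer): with an exact minimizer at each QIS step,
after finitely many steps `t^K ≥ t*` and every global minimizer of
`W(·, t^K)` belongs to the admissible set of bounded-distortion
configurations. -/
theorem qis_idealized_minimizer
    {ι E : Type*} [Fintype ι] [Nonempty ι]
    (v : ι → ℝ) (hv : ∀ i, 0 < v i)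
    (f : ι → E → ℝ) (hf : ∀ i X, 1 ≤ f i X)
    (tstar : ℝ) (htstar : tstar ∈ Set.Ioo (0:ℝ) 1)
    (Xstar : E) (hfeas : tstar * fplus f Xstar < 1)
    (σ : ℝ) (hσ : σ ∈ Set.Ioo (0:ℝ) 1)
    (X : ℕ → E) (t : ℕ → ℝ)
    (ht0 : 0 ≤ t 0) (ht0' : t 0 < tstar)
    (ht0f : t 0 * fplus f (X 0) < 1)
    (hupd : ∀ k, t (k + 1) =
      t k + σ * (1 - t k * fplus f (X (k + 1))) / fplus f (X (k + 1)))
    (hmin : ∀ k, W v f (X (k + 1)) (t k) = ⨅ Y : E, W v f Y (t k)) :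
    ∃ K : ℕ, tstar ≤ t K ∧
      ∀ Y : E, (W v f Y (t K) = ⨅ Y' : E, W v f Y' (t K)) →
        ∀ i, f i Y < 1 / tstar := by
  obtain ⟨δ, hδ, hstep⟩ := exists_pos_le_of_W_le hv hf (W_lt_top_iff (v := v).2 hfeas)
  have hW : ∀ k, 0 ≤ t k → t k < tstar → W v f (X (k + 1)) (t k) ≤ W v f Xstar tstar :=
    fun k h0 hk => (hmin k).trans_le ((iInf_le _ Xstar).trans (W_mono hv hf h0 hk.le))
  have hinc : ∀ k, 0 ≤ t k → t k < tstar → t k + σ * δ ≤ t (k + 1) := by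
    intro k h0 hk
    rw [hupd k, mul_div_assoc]
    have := mul_le_mul_of_nonneg_left (hstep _ _ h0 (hW k h0 hk)) hσ.1.le
    linarith
  have hσδ : 0 < σ * δ := mul_pos hσ.1 hδ
  have hgrow : ∀ k, (∀ j < k, t j < tstar) → k * (σ * δ) ≤ t k := by
    intro k
    induction k with
    | zero => intro _; simpa using ht0
    | succ k ih =>
      intro h
      have hk := ih fun j hj => h j (by omega)
      have := hinc k (le_trans (by positivity) hk) (h k (by omega))
      push_cast
      linarith
  have hex : ∃ K, tstar ≤ t K := by
    by_contra! hlt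
    obtain ⟨n, hn⟩ := exists_nat_gt (tstar / (σ * δ))
    rw [div_lt_iff₀ hσδ] at hn
    linarith [hgrow n fun j _ => hlt j, hlt n]
  classical
  obtain ⟨K, hK, hfirst⟩ : ∃ K, tstar ≤ t K ∧ ∀ j < K, t j < tstar :=
    ⟨Nat.find hex, Nat.find_spec hex, fun j hj => not_le.1 (Nat.find_min hex hj)⟩
  refine ⟨K, hK, fun Y hY i => ?_⟩
  obtain _ | k := K
  · linarith
  have h0 : 0 ≤ t k := le_trans (by positivity) (hgrow k fun j hj => hfirst j (by omega))
  have hk : t k * fplus f (X (k + 1)) < 1 :=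
    W_lt_top_iff.1 ((hW k h0 (hfirst k (by omega))).trans_lt (W_lt_top_iff.2 hfeas))
  have hpos : 0 < fplus f (X (k + 1)) := by linarith [one_le_fplus hf (X (k + 1))]
  have hfin : t (k + 1) * fplus f (X (k + 1)) < 1 := by
    rw [hupd k, add_mul, div_mul_cancel₀ _ hpos.ne']
    nlinarith [hσ.2]
  have hYfin : t (k + 1) * fplus f Y < 1 :=
    W_lt_top_iff.1 ((hY.trans_le (iInf_le _ (X (k + 1)))).trans_lt (W_lt_top_iff (v := v).2 hfin))
  have hpK : 0 < t (k + 1) := htstar.1.trans_le hK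
  rw [lt_div_iff₀ htstar.1]
  nlinarith [one_sub_mul_pos hpK.le hYfin i, hf i Y]
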